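/- arXiv:2212.06549 — 3 statements merged into one kernel-verified Lean document; each statement's English description precedes it below -/
import Mathlib

section
/- Let λ ∈ ℝ and μ > 0, and define F : {(y¹,y²) ∈ ℝ² : y¹ > 0} → ℝ by F(y¹, y²) = μ·√((y¹)² + (y²)²)·exp(−λ·arctan(y²/y¹)). Then F is smooth and positive, F is positively 1-homogeneous (F(s·y) = s·F(y) for all s > 0), F satisfies (λy¹ − y²)·∂F/∂y¹ + (y¹ + λy²)·∂F/∂y² = 0 everywhere, and the Hessian of F²/2 is positive definite at every point of the domain. -/
open Real Set

/-- The Hessian bilinear form of a function `G : ℝ × ℝ → ℝ` at `y`. -/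
noncomputable def hessian (G : ℝ × ℝ → ℝ) (y u v : ℝ × ℝ) : ℝ :=
  fderiv ℝ (fderiv ℝ G) y u v

lemma spiral_arctan (z : ℝ × ℝ) (hz : 0 < z.1) :
    HasFDerivAt (fun z : ℝ × ℝ => Real.arctan (z.2 / z.1))
      ((1 / (z.1 ^ 2 + z.2 ^ 2)) •
        (z.1 • ContinuousLinearMap.snd ℝ ℝ ℝ - z.2 • ContinuousLinearMap.fst ℝ ℝ ℝ)) z := by
  have h1 : HasFDerivAt (fun z : ℝ × ℝ => z.1) (ContinuousLinearMap.fst ℝ ℝ ℝ) z := hasFDerivAt_fst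
  have h2 : HasFDerivAt (fun z : ℝ × ℝ => z.2) (ContinuousLinearMap.snd ℝ ℝ ℝ) z := hasFDerivAt_snd
  have hi := (hasDerivAt_inv hz.ne').comp_hasFDerivAt z h1
  have h := (h2.mul hi).arctan
  have hr : z.1 ^ 2 + z.2 ^ 2 ≠ 0 := by positivity
  have hz' := hz.ne'
  refine (h.congr_fderiv ?_)
  ext <;> simp <;> field_simp

lemma spiral_exp (c : ℝ) (z : ℝ × ℝ) (hz : 0 < z.1) :
    HasFDerivAt (fun z : ℝ × ℝ => Real.exp (c * Real.arctan (z.2 / z.1)))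
      ((Real.exp (c * Real.arctan (z.2 / z.1)) * c / (z.1 ^ 2 + z.2 ^ 2)) •
        (z.1 • ContinuousLinearMap.snd ℝ ℝ ℝ - z.2 • ContinuousLinearMap.fst ℝ ℝ ℝ)) z := by
  refine ((spiral_arctan z hz).const_mul c).exp.congr_fderiv ?_
  ext <;> simp <;> ring

lemma spiral_F (lam μ : ℝ) (z : ℝ × ℝ) (hz : 0 < z.1) :
    HasFDerivAt (fun y : ℝ × ℝ =>
      μ * Real.sqrt (y.1 ^ 2 + y.2 ^ 2) * Real.exp (-lam * Real.arctan (y.2 / y.1)))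
      ((μ * Real.exp (-lam * Real.arctan (z.2 / z.1)) / Real.sqrt (z.1 ^ 2 + z.2 ^ 2)) •
        ((z.1 + lam * z.2) • ContinuousLinearMap.fst ℝ ℝ ℝ +
          (z.2 - lam * z.1) • ContinuousLinearMap.snd ℝ ℝ ℝ)) z := by
  have h1 : HasFDerivAt (fun z : ℝ × ℝ => z.1) (ContinuousLinearMap.fst ℝ ℝ ℝ) z := hasFDerivAt_fst
  have h2 : HasFDerivAt (fun z : ℝ × ℝ => z.2) (ContinuousLinearMap.snd ℝ ℝ ℝ) z := hasFDerivAt_snd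
  have hr : 0 < z.1 ^ 2 + z.2 ^ 2 := by positivity
  have h := ((((h1.pow 2).add (h2.pow 2)).sqrt hr.ne').const_mul μ).mul (spiral_exp (-lam) z hz)
  refine h.congr_fderiv ?_
  have hs : Real.sqrt (z.1 ^ 2 + z.2 ^ 2) ≠ 0 := (Real.sqrt_pos.2 hr).ne'
  have hs2 : z.1 ^ 2 + z.2 ^ 2 = Real.sqrt (z.1 ^ 2 + z.2 ^ 2) ^ 2 := (Real.sq_sqrt hr.le).symm
  have key : Real.sqrt (z.1 ^ 2 + z.2 ^ 2) / (z.1 ^ 2 + z.2 ^ 2)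
      = 1 / Real.sqrt (z.1 ^ 2 + z.2 ^ 2) := by
    rw [div_eq_div_iff hr.ne' hs]; nlinarith
  generalize Real.exp (-lam * Real.arctan (z.2 / z.1)) = e at *
  have key2 : ∀ w : ℝ, μ * Real.sqrt (z.1 ^ 2 + z.2 ^ 2) * (e * -lam / (z.1 ^ 2 + z.2 ^ 2) * w)
      = μ * (e * -lam) * w / Real.sqrt (z.1 ^ 2 + z.2 ^ 2) := by
    intro w
    linear_combination (μ * (e * -lam) * w) * key
  ext
  · simp
    have := key2 (-z.2)
    simp at this
    rw [this]; field_simp; ring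
  · simp
    have := key2 z.1
    simp at this
    rw [this]; field_simp; ring

lemma spiral_G (lam μ : ℝ) (z : ℝ × ℝ) (hz : 0 < z.1) :
    HasFDerivAt (fun y : ℝ × ℝ =>
      (μ * Real.sqrt (y.1 ^ 2 + y.2 ^ 2) * Real.exp (-lam * Real.arctan (y.2 / y.1))) ^ 2 / 2)
      ((μ ^ 2 * Real.exp ((-2 * lam) * Real.arctan (z.2 / z.1))) •
        ((z.1 + lam * z.2) • ContinuousLinearMap.fst ℝ ℝ ℝ +
          (z.2 - lam * z.1) • ContinuousLinearMap.snd ℝ ℝ ℝ)) z := by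
  have hr : 0 < z.1 ^ 2 + z.2 ^ 2 := by positivity
  have hs : Real.sqrt (z.1 ^ 2 + z.2 ^ 2) ≠ 0 := (Real.sqrt_pos.2 hr).ne'
  have h := ((spiral_F lam μ z hz).pow 2).mul_const ((2 : ℝ)⁻¹)
  simp only [div_eq_mul_inv _ (2 : ℝ)]
  refine h.congr_fderiv ?_
  have he : Real.exp ((-2 * lam) * Real.arctan (z.2 / z.1))
      = Real.exp (-lam * Real.arctan (z.2 / z.1)) ^ 2 := by
    rw [← Real.exp_nat_mul]; congr 1; push_cast; ring
  rw [he]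
  generalize Real.exp (-lam * Real.arctan (z.2 / z.1)) = e
  generalize Real.sqrt (z.1 ^ 2 + z.2 ^ 2) = s at *
  ext <;> simp <;> field_simp

lemma spiral_G2 (lam μ : ℝ) (z : ℝ × ℝ) (hz : 0 < z.1) (u : ℝ × ℝ) :
    fderiv ℝ (fderiv ℝ (fun y : ℝ × ℝ =>
      (μ * Real.sqrt (y.1 ^ 2 + y.2 ^ 2) * Real.exp (-lam * Real.arctan (y.2 / y.1))) ^ 2 / 2)) z u u
      = μ ^ 2 * Real.exp ((-2 * lam) * Real.arctan (z.2 / z.1)) / (z.1 ^ 2 + z.2 ^ 2) *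
        (((z.1 * u.1 + z.2 * u.2) - lam * (z.1 * u.2 - z.2 * u.1)) ^ 2
          + (1 + lam ^ 2) * (z.1 * u.2 - z.2 * u.1) ^ 2) := by
  have hr : 0 < z.1 ^ 2 + z.2 ^ 2 := by positivity
  have hev : fderiv ℝ (fun y : ℝ × ℝ =>
      (μ * Real.sqrt (y.1 ^ 2 + y.2 ^ 2) * Real.exp (-lam * Real.arctan (y.2 / y.1))) ^ 2 / 2)
      =ᶠ[nhds z] fun z => ((μ ^ 2 * Real.exp ((-2 * lam) * Real.arctan (z.2 / z.1))) •
        ((z.1 + lam * z.2) • ContinuousLinearMap.fst ℝ ℝ ℝ +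
          (z.2 - lam * z.1) • ContinuousLinearMap.snd ℝ ℝ ℝ)) := by
    filter_upwards [(isOpen_lt continuous_const continuous_fst).mem_nhds hz] with w hw
    exact (spiral_G lam μ w hw).fderiv
  rw [hev.fderiv_eq]
  have h1 : HasFDerivAt (fun z : ℝ × ℝ => z.1) (ContinuousLinearMap.fst ℝ ℝ ℝ) z := hasFDerivAt_fst
  have h2 : HasFDerivAt (fun z : ℝ × ℝ => z.2) (ContinuousLinearMap.snd ℝ ℝ ℝ) z := hasFDerivAt_snd
  have h := ((spiral_exp (-2 * lam) z hz).const_mul (μ ^ 2)).smul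
    (((h1.add (h2.const_mul lam)).smul_const (ContinuousLinearMap.fst ℝ ℝ ℝ)).add
      ((h2.sub (h1.const_mul lam)).smul_const (ContinuousLinearMap.snd ℝ ℝ ℝ)))
  have h' := h.fderiv
  refine (congrArg (fun L => L u u) h').trans ?_
  simp
  field_simp
  ring

theorem spiral_conic_minkowski_norm (lam μ : ℝ) (hμ : 0 < μ) :
    let Ω : Set (ℝ × ℝ) := {y : ℝ × ℝ | 0 < y.1}
    let F : ℝ × ℝ → ℝ := fun y =>
      μ * Real.sqrt (y.1 ^ 2 + y.2 ^ 2) * Real.exp (-lam * Real.arctan (y.2 / y.1))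
    ContDiffOn ℝ (⊤ : ℕ∞) F Ω ∧
    (∀ y ∈ Ω, 0 < F y) ∧
    (∀ y ∈ Ω, ∀ s : ℝ, 0 < s → F (s • y) = s * F y) ∧
    (∀ y ∈ Ω,
      (lam * y.1 - y.2) * fderiv ℝ F y ((1, 0) : ℝ × ℝ) +
        (y.1 + lam * y.2) * fderiv ℝ F y ((0, 1) : ℝ × ℝ) = 0) ∧
    (∀ y ∈ Ω, ∀ u : ℝ × ℝ, u ≠ 0 →
      0 < hessian (fun z => F z ^ 2 / 2) y u u) := by
  intro Ω F
  refine ⟨?_, ?_, ?_, ?_, ?_⟩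
  · intro y hy
    have hy : 0 < y.1 := hy
    have hr : 0 < y.1 ^ 2 + y.2 ^ 2 := by positivity
    apply ContDiffAt.contDiffWithinAt
    have a1 : ContDiffAt ℝ (⊤ : ℕ∞) (fun y : ℝ × ℝ => y.1 ^ 2 + y.2 ^ 2) y :=
      (contDiffAt_fst.pow 2).add (contDiffAt_snd.pow 2)
    have a2 : ContDiffAt ℝ (⊤ : ℕ∞) (fun y : ℝ × ℝ => y.2 / y.1) y :=
      contDiffAt_snd.div contDiffAt_fst hy.ne'
    exact (contDiffAt_const.mul (a1.sqrt hr.ne')).mul (contDiffAt_const.mul a2.arctan).exp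
  · intro y hy
    have hy : 0 < y.1 := hy
    have hr : 0 < y.1 ^ 2 + y.2 ^ 2 := by positivity
    have := Real.sqrt_pos.2 hr
    exact mul_pos (mul_pos hμ this) (Real.exp_pos _)
  · intro y hy s hs
    have e1 : (s * y.1) ^ 2 + (s * y.2) ^ 2 = s ^ 2 * (y.1 ^ 2 + y.2 ^ 2) := by ring
    simp only [F, Prod.smul_fst, Prod.smul_snd, smul_eq_mul]
    rw [e1, Real.sqrt_mul (sq_nonneg s), Real.sqrt_sq hs.le, mul_div_mul_left _ _ hs.ne']
    ring
  · intro y hy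
    rw [(spiral_F lam μ y hy).fderiv]
    simp
    ring
  · intro y hy u hu
    have hy : 0 < y.1 := hy
    have hr : 0 < y.1 ^ 2 + y.2 ^ 2 := by positivity
    unfold hessian
    rw [spiral_G2 lam μ y hy u]
    refine mul_pos (by positivity) ?_
    by_contra hn
    have hq : (y.1 * u.2 - y.2 * u.1) ^ 2 = 0 := by
      nlinarith [sq_nonneg (y.1 * u.2 - y.2 * u.1), sq_nonneg (lam * (y.1 * u.2 - y.2 * u.1)),
        sq_nonneg ((y.1 * u.1 + y.2 * u.2) - lam * (y.1 * u.2 - y.2 * u.1))]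
    have hq' := pow_eq_zero_iff (two_ne_zero) |>.1 hq
    rw [hq'] at hn
    have hp : (y.1 * u.1 + y.2 * u.2) ^ 2 = 0 := by
      nlinarith [sq_nonneg (y.1 * u.1 + y.2 * u.2)]
    have hu2 : (y.1 ^ 2 + y.2 ^ 2) * (u.1 ^ 2 + u.2 ^ 2) = 0 := by
      linear_combination hp + hq
    have hu3 := (mul_eq_zero.1 hu2).resolve_left hr.ne'
    apply hu
    ext
    · simp; nlinarith [sq_nonneg u.1, sq_nonneg u.2]
    · simp; nlinarith [sq_nonneg u.1, sq_nonneg u.2]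
end

section
/- Let λ₁ > λ₂ > 0 and μ > 0, and define F on the open quadrant {(y¹,y²) ∈ ℝ² : y¹ > 0, y² > 0} by F(y¹, y²) = μ·(y¹)^{−λ₂/(λ₁−λ₂)}·(y²)^{λ₁/(λ₁−λ₂)}. Then F is smooth and positive, F is positively 1-homogeneous (F(s·y) = s·F(y) for all s > 0), F satisfies λ₁y¹·∂F/∂y¹ + λ₂y²·∂F/∂y² = 0 everywhere, and the Hessian of F²/2 is positive definite at every point of the quadrant. -/
open Real Set

theorem monomial_hasFDerivAt (c p q : ℝ) (z : ℝ × ℝ) (h1 : 0 < z.1) (h2 : 0 < z.2) :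
    HasFDerivAt (fun z : ℝ × ℝ => c * z.1 ^ p * z.2 ^ q)
      ((c * p * z.1 ^ (p - 1) * z.2 ^ q) • ContinuousLinearMap.fst ℝ ℝ ℝ +
        (c * q * z.1 ^ p * z.2 ^ (q - 1)) • ContinuousLinearMap.snd ℝ ℝ ℝ) z := by
  have e1 : HasFDerivAt (fun z : ℝ × ℝ => z.1 ^ p) _ z :=
    (hasFDerivAt_fst (𝕜 := ℝ) (p := z)).rpow_const (Or.inl h1.ne')
  have e2 : HasFDerivAt (fun z : ℝ × ℝ => z.2 ^ q) _ z :=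
    (hasFDerivAt_snd (𝕜 := ℝ) (p := z)).rpow_const (Or.inl h2.ne')
  have e3 := (e1.const_mul c).mul e2
  refine e3.congr_fderiv ?_
  ext <;> simp <;> ring

theorem quadrant_eventually (y : ℝ × ℝ) (h1 : 0 < y.1) (h2 : 0 < y.2) :
    ∀ᶠ z in nhds y, 0 < z.1 ∧ 0 < z.2 :=
  (continuous_fst.continuousAt.eventually (lt_mem_nhds h1)).and
    (continuous_snd.continuousAt.eventually (lt_mem_nhds h2))

theorem monomial_hessian (c p q : ℝ) (y u : ℝ × ℝ) (h1 : 0 < y.1) (h2 : 0 < y.2) :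
    fderiv ℝ (fderiv ℝ (fun z : ℝ × ℝ => c * z.1 ^ p * z.2 ^ q)) y u u =
      c * (y.1 ^ (p - 2) * y.2 ^ (q - 2)) * (p * (p - 1) * (u.1 * y.2) ^ 2
        + 2 * p * q * (u.1 * y.2) * (u.2 * y.1) + q * (q - 1) * (u.2 * y.1) ^ 2) := by
  have key : fderiv ℝ (fun z : ℝ × ℝ => c * z.1 ^ p * z.2 ^ q) =ᶠ[nhds y]
      fun z => (c * p * z.1 ^ (p - 1) * z.2 ^ q) • ContinuousLinearMap.fst ℝ ℝ ℝ +
        (c * q * z.1 ^ p * z.2 ^ (q - 1)) • ContinuousLinearMap.snd ℝ ℝ ℝ := by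
    filter_upwards [quadrant_eventually y h1 h2] with z hz
    exact (monomial_hasFDerivAt c p q z hz.1 hz.2).fderiv
  rw [key.fderiv_eq]
  have d1 := (monomial_hasFDerivAt (c * p) (p - 1) q y h1 h2).smul_const
    (ContinuousLinearMap.fst ℝ ℝ ℝ)
  have d2 := (monomial_hasFDerivAt (c * q) p (q - 1) y h1 h2).smul_const
    (ContinuousLinearMap.snd ℝ ℝ ℝ)
  have d3 : HasFDerivAt (fun z : ℝ × ℝ =>
      (c * p * z.1 ^ (p - 1) * z.2 ^ q) • ContinuousLinearMap.fst ℝ ℝ ℝ +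
        (c * q * z.1 ^ p * z.2 ^ (q - 1)) • ContinuousLinearMap.snd ℝ ℝ ℝ) _ y := d1.add d2
  rw [d3.fderiv]
  have r1 : ∀ (x r : ℝ), 0 < x → x ^ (r - 1) = x ^ (r - 2) * x := by
    intro x r hx
    rw [← Real.rpow_add_one hx.ne']; congr 1; ring
  have r2 : ∀ (x r : ℝ), 0 < x → x ^ r = x ^ (r - 2) * x * x := by
    intro x r hx
    rw [← r1 x r hx, ← Real.rpow_add_one hx.ne']; congr 1; ring
  have r3 : ∀ (r : ℝ), r - 1 - 1 = r - 2 := fun r => by ring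
  simp only [ContinuousLinearMap.add_apply, ContinuousLinearMap.smulRight_apply,
    ContinuousLinearMap.smul_apply, ContinuousLinearMap.coe_fst', ContinuousLinearMap.coe_snd',
    smul_eq_mul, r3]
  rw [r1 y.1 p h1, r1 y.2 q h2, r2 y.1 p h1, r2 y.2 q h2]
  ring

theorem power_conic_minkowski_norm (lam₁ lam₂ μ : ℝ)
    (h₁₂ : lam₂ < lam₁) (h₂ : 0 < lam₂) (hμ : 0 < μ) :
    let Ω : Set (ℝ × ℝ) := {y : ℝ × ℝ | 0 < y.1 ∧ 0 < y.2}
    let F : ℝ × ℝ → ℝ := fun y =>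
      μ * y.1 ^ (-(lam₂ / (lam₁ - lam₂))) * y.2 ^ (lam₁ / (lam₁ - lam₂))
    ContDiffOn ℝ (⊤ : ℕ∞) F Ω ∧
    (∀ y ∈ Ω, 0 < F y) ∧
    (∀ y ∈ Ω, ∀ s : ℝ, 0 < s → F (s • y) = s * F y) ∧
    (∀ y ∈ Ω,
      lam₁ * y.1 * fderiv ℝ F y ((1, 0) : ℝ × ℝ) +
        lam₂ * y.2 * fderiv ℝ F y ((0, 1) : ℝ × ℝ) = 0) ∧
    (∀ y ∈ Ω, ∀ u : ℝ × ℝ, u ≠ 0 →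
      0 < hessian (fun z => F z ^ 2 / 2) y u u) := by
  intro Ω F
  have hd : 0 < lam₁ - lam₂ := sub_pos.2 h₁₂
  obtain ⟨a, ha⟩ : ∃ a, a = lam₂ / (lam₁ - lam₂) := ⟨_, rfl⟩
  have hb : lam₁ / (lam₁ - lam₂) = a + 1 := by rw [ha]; field_simp; ring
  have ha0 : 0 < a := by rw [ha]; positivity
  have hrel : lam₁ * a = lam₂ * (a + 1) := by rw [ha]; field_simp; ring
  have hF : F = fun y => μ * y.1 ^ (-a) * y.2 ^ (a + 1) := by
    funext y; simp only [F, hb, ← ha]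
  clear_value F
  subst hF
  refine ⟨?_, ?_, ?_, ?_, ?_⟩
  · intro y hy
    have c1 : ContDiffAt ℝ (⊤ : ℕ∞) (fun z : ℝ × ℝ => z.1 ^ (-a)) y :=
      contDiffAt_fst.rpow_const_of_ne hy.1.ne'
    have c2 : ContDiffAt ℝ (⊤ : ℕ∞) (fun z : ℝ × ℝ => z.2 ^ (a + 1)) y :=
      contDiffAt_snd.rpow_const_of_ne hy.2.ne'
    exact ((contDiffAt_const.mul c1).mul c2).contDiffWithinAt
  · rintro y ⟨h1, h2⟩
    have := Real.rpow_pos_of_pos h1 (-a)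
    have := Real.rpow_pos_of_pos h2 (a + 1)
    positivity
  · rintro y ⟨h1, h2⟩ s hs
    simp only [Prod.smul_fst, Prod.smul_snd, smul_eq_mul]
    rw [Real.mul_rpow hs.le h1.le, Real.mul_rpow hs.le h2.le]
    have : s ^ (-a) * s ^ (a + 1) = s := by
      rw [← Real.rpow_add hs]; simp
    linear_combination (μ * y.1 ^ (-a) * y.2 ^ (a + 1)) * this
  · rintro y ⟨h1, h2⟩
    rw [(monomial_hasFDerivAt μ (-a) (a + 1) y h1 h2).fderiv]
    have e1 : y.1 ^ (-a) = y.1 ^ (-a - 1) * y.1 := by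
      rw [← Real.rpow_add_one h1.ne']; congr 1; ring
    have e2 : y.2 ^ (a + 1) = y.2 ^ (a + 1 - 1) * y.2 := by
      rw [← Real.rpow_add_one h2.ne']; congr 1; ring
    simp only [ContinuousLinearMap.add_apply,
      ContinuousLinearMap.smul_apply, ContinuousLinearMap.coe_fst', ContinuousLinearMap.coe_snd',
      smul_eq_mul]
    rw [e1, e2]
    linear_combination (-μ * y.1 ^ (-a - 1) * y.1 * y.2 ^ (a + 1 - 1) * y.2) * hrel
  · rintro y ⟨h1, h2⟩ u hu
    have key : (fun z : ℝ × ℝ => (μ * z.1 ^ (-a) * z.2 ^ (a + 1)) ^ 2 / 2) =ᶠ[nhds y]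
        fun z => (μ ^ 2 / 2) * z.1 ^ (-(2 * a)) * z.2 ^ (2 * a + 2) := by
      filter_upwards [quadrant_eventually y h1 h2] with z hz
      have e1 : z.1 ^ (-(2 * a)) = z.1 ^ (-a) * z.1 ^ (-a) := by
        rw [← Real.rpow_add hz.1]; congr 1; ring
      have e2 : z.2 ^ (2 * a + 2) = z.2 ^ (a + 1) * z.2 ^ (a + 1) := by
        rw [← Real.rpow_add hz.2]; congr 1; ring
      rw [e1, e2]; ring
    unfold hessian
    rw [key.fderiv.fderiv_eq, monomial_hessian _ _ _ y u h1 h2]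
    have p1 := Real.rpow_pos_of_pos h1 (-(2 * a) - 2)
    have p2 := Real.rpow_pos_of_pos h2 (2 * a + 2 - 2)
    refine mul_pos (by positivity) ?_
    have hXY : u.1 * y.2 ≠ 0 ∨ u.2 * y.1 ≠ 0 := by
      by_contra! h
      apply hu
      ext
      · simpa [h2.ne'] using h.1
      · simpa [h1.ne'] using h.2
    generalize u.1 * y.2 = X at *
    generalize u.2 * y.1 = Y at *
    have hk : 0 < a * (2 * a + 1) := by positivity
    refine pos_of_mul_pos_right (a := a * (2 * a + 1)) ?_ hk.le
    have : a * (2 * a + 1) * (-(2 * a) * (-(2 * a) - 1) * X ^ 2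
        + 2 * -(2 * a) * (2 * a + 2) * X * Y + (2 * a + 2) * (2 * a + 2 - 1) * Y ^ 2)
        = 2 * ((a * (2 * a + 1) * X - 2 * a * (a + 1) * Y) ^ 2 + a * (a + 1) * Y ^ 2) := by
      ring
    rw [this]
    by_cases hY : Y = 0
    · have hX : X ≠ 0 := by simpa [hY] using hXY
      subst hY
      have : 0 < (a * (2 * a + 1) * X) ^ 2 := by positivity
      simpa using this
    · have : 0 < a * (a + 1) * Y ^ 2 := by positivity
      have := sq_nonneg (a * (2 * a + 1) * X - 2 * a * (a + 1) * Y)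
      linarith
end

section
/- Let λ > 0 and μ > 0, and define F : {(y¹,y²) ∈ ℝ² : y¹ > 0} → ℝ by F(y¹, y²) = μ·y¹·exp(−λ·y²/y¹). Then F is smooth and positive, F is positively 1-homogeneous (F(s·y) = s·F(y) for all s > 0), F satisfies λy¹·∂F/∂y¹ + (y¹ + λy²)·∂F/∂y² = 0 everywhere, and the Hessian of F²/2 is positive definite at every point of the domain. -/
open Real Set

lemma aux_h (a : ℝ) (y : ℝ × ℝ) (hy : 0 < y.1) :
    HasFDerivAt (fun z : ℝ × ℝ => Real.exp (-a * z.2 / z.1))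
      ((Real.exp (-a * y.2 / y.1) * (a * y.2 / y.1 ^ 2)) • ContinuousLinearMap.fst ℝ ℝ ℝ +
       (Real.exp (-a * y.2 / y.1) * (-a / y.1)) • ContinuousLinearMap.snd ℝ ℝ ℝ) y := by
  have h1 : HasFDerivAt (fun z : ℝ × ℝ => z.1) (ContinuousLinearMap.fst ℝ ℝ ℝ) y := hasFDerivAt_fst
  have h2 : HasFDerivAt (fun z : ℝ × ℝ => z.2) (ContinuousLinearMap.snd ℝ ℝ ℝ) y := hasFDerivAt_snd
  have h3 := (hasDerivAt_inv hy.ne').comp_hasFDerivAt y h1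
  have h4 := ((h2.const_mul (-a)).mul h3).exp
  refine (h4.congr_fderiv ?_)
  ext
  · simp [div_eq_mul_inv]
    try ring
  · simp [div_eq_mul_inv]
    try ring

lemma aux_F (a μ : ℝ) (y : ℝ × ℝ) (hy : 0 < y.1) :
    HasFDerivAt (fun z : ℝ × ℝ => μ * z.1 * Real.exp (-a * z.2 / z.1))
      ((μ * Real.exp (-a * y.2 / y.1) * (1 + a * y.2 / y.1)) • ContinuousLinearMap.fst ℝ ℝ ℝ +
       (μ * Real.exp (-a * y.2 / y.1) * (-a)) • ContinuousLinearMap.snd ℝ ℝ ℝ) y := by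
  have h1 : HasFDerivAt (fun z : ℝ × ℝ => z.1) (ContinuousLinearMap.fst ℝ ℝ ℝ) y := hasFDerivAt_fst
  have h4 := (h1.const_mul μ).mul (aux_h a y hy)
  refine (h4.congr_fderiv ?_)
  have := hy.ne'
  ext
  · simp; field_simp; ring
  · simp; field_simp

lemma aux_G (a μ : ℝ) (y : ℝ × ℝ) (hy : 0 < y.1) :
    HasFDerivAt (fun z : ℝ × ℝ => (μ * z.1 * Real.exp (-a * z.2 / z.1)) ^ 2 / 2)
      ((μ ^ 2 * Real.exp (-a * y.2 / y.1) ^ 2 * (y.1 + a * y.2)) • ContinuousLinearMap.fst ℝ ℝ ℝ +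
       (μ ^ 2 * Real.exp (-a * y.2 / y.1) ^ 2 * (-a * y.1)) • ContinuousLinearMap.snd ℝ ℝ ℝ) y := by
  have h4 := ((aux_F a μ y hy).pow 2).mul_const (2⁻¹ : ℝ)
  simp only [div_eq_mul_inv _ (2 : ℝ)]
  refine (h4.congr_fderiv ?_)
  have := hy.ne'
  ext
  · simp; field_simp
  · simp; field_simp

lemma aux_H (a μ : ℝ) (y : ℝ × ℝ) (hy : 0 < y.1) (u : ℝ × ℝ) :
    hessian (fun z : ℝ × ℝ => (μ * z.1 * Real.exp (-a * z.2 / z.1)) ^ 2 / 2) y u u =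
      μ ^ 2 * Real.exp (-a * y.2 / y.1) ^ 2 *
        ((u.1 - a * u.2 + a * y.2 / y.1 * u.1) ^ 2 + (a * u.2 - a * y.2 / y.1 * u.1) ^ 2) := by
  have hev : fderiv ℝ (fun z : ℝ × ℝ => (μ * z.1 * Real.exp (-a * z.2 / z.1)) ^ 2 / 2)
      =ᶠ[nhds y] fun y =>
      ((μ ^ 2 * Real.exp (-a * y.2 / y.1) ^ 2 * (y.1 + a * y.2)) • ContinuousLinearMap.fst ℝ ℝ ℝ +
       (μ ^ 2 * Real.exp (-a * y.2 / y.1) ^ 2 * (-a * y.1)) • ContinuousLinearMap.snd ℝ ℝ ℝ) := by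
    filter_upwards [(isOpen_lt continuous_const continuous_fst).mem_nhds hy] with z hz
    exact (aux_G a μ z hz).fderiv
  have h1 : HasFDerivAt (fun z : ℝ × ℝ => z.1) (ContinuousLinearMap.fst ℝ ℝ ℝ) y := hasFDerivAt_fst
  have h2 : HasFDerivAt (fun z : ℝ × ℝ => z.2) (ContinuousLinearMap.snd ℝ ℝ ℝ) y := hasFDerivAt_snd
  have hE := ((aux_h a y hy).pow 2).const_mul (μ ^ 2)
  have hA := (hE.mul (h1.add (h2.const_mul a))).smul_const (ContinuousLinearMap.fst ℝ ℝ ℝ)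
  have hB := (hE.mul (h1.const_mul (-a))).smul_const (ContinuousLinearMap.snd ℝ ℝ ℝ)
  have hAB := (hA.add hB).fderiv
  unfold hessian
  rw [hev.fderiv_eq]
  refine (congrArg (fun L => L u u) hAB).trans ?_
  have := hy.ne'
  simp
  field_simp
  ring

theorem log_spiral_conic_minkowski_norm (lam μ : ℝ) (hlam : 0 < lam) (hμ : 0 < μ) :
    let Ω : Set (ℝ × ℝ) := {y : ℝ × ℝ | 0 < y.1}
    let F : ℝ × ℝ → ℝ := fun y => μ * y.1 * Real.exp (-lam * y.2 / y.1)
    ContDiffOn ℝ (⊤ : ℕ∞) F Ω ∧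
    (∀ y ∈ Ω, 0 < F y) ∧
    (∀ y ∈ Ω, ∀ s : ℝ, 0 < s → F (s • y) = s * F y) ∧
    (∀ y ∈ Ω,
      lam * y.1 * fderiv ℝ F y ((1, 0) : ℝ × ℝ) +
        (y.1 + lam * y.2) * fderiv ℝ F y ((0, 1) : ℝ × ℝ) = 0) ∧
    (∀ y ∈ Ω, ∀ u : ℝ × ℝ, u ≠ 0 →
      0 < hessian (fun z => F z ^ 2 / 2) y u u) := by
  intro Ω F
  refine ⟨?_, ?_, ?_, ?_, ?_⟩
  · have hd : ContDiffOn ℝ (⊤ : ℕ∞) (fun y : ℝ × ℝ => -lam * y.2 / y.1) Ω :=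
      ContDiffOn.div (by fun_prop) (by fun_prop) (fun y hy => ne_of_gt hy)
    exact ContDiffOn.mul (by fun_prop) hd.exp
  · intro y hy
    have : 0 < y.1 := hy
    simp only [F]
    positivity
  · intro y hy s hs
    have : 0 < y.1 := hy
    have e : -lam * (s * y.2) / (s * y.1) = -lam * y.2 / y.1 := by field_simp
    simp only [F, Prod.smul_fst, Prod.smul_snd, smul_eq_mul, e]
    ring
  · intro y hy
    have h0 : 0 < y.1 := hy
    rw [(aux_F lam μ y hy).fderiv]
    simp
    field_simp
    ring
  · intro y hy u hu
    have h0 : 0 < y.1 := hy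
    rw [aux_H lam μ y hy u]
    have hE : 0 < μ ^ 2 * Real.exp (-lam * y.2 / y.1) ^ 2 := by positivity
    refine mul_pos hE ?_
    by_contra hn
    set p := u.1 - lam * u.2 + lam * y.2 / y.1 * u.1 with hp
    set q := lam * u.2 - lam * y.2 / y.1 * u.1 with hq
    have hp0 : p = 0 := by nlinarith [sq_nonneg p, sq_nonneg q]
    have hq0 : q = 0 := by nlinarith [sq_nonneg p, sq_nonneg q]
    have hu1 : u.1 = 0 := by linarith
    have hu2 : lam * u.2 = 0 := by rw [hu1] at hq; linarith
    exact hu (Prod.ext hu1 ((mul_eq_zero.mp hu2).resolve_left hlam.ne'))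
end
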